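/- arXiv:1505.06490 — 3 statements merged into one kernel-verified Lean document; each statement's English description precedes it below -/
import Mathlib

section
/- Let n ≥ 2, 0 < α < 1, and m ≥ 1 a natural number. The map g_m defined on the closed unit ball of ℝⁿ by g_m(x) = ((1+‖x‖^α)/‖x‖)·x for 1/m ≤ ‖x‖ ≤ 1 and g_m(x) = m·(1+(1/m)^α)·x for ‖x‖ < 1/m is Lipschitz continuous on the closed unit ball (i.e., there exists a constant L_m with ‖g_m(x) − g_m(y)‖ ≤ L_m‖x−y‖ for all x, y in the closed unit ball). -/
/-- The radial factor `t ↦ (1 + t ^ α) / t` is Lipschitz on `[δ, 1]` for `δ > 0`. -/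
theorem exists_lipschitzOnWith_one_add_rpow_div (α : ℝ) {δ : ℝ} (hδ : 0 < δ) :
    ∃ K, LipschitzOnWith K (fun t : ℝ => (1 + t ^ α) / t) (Set.Icc δ 1) := by
  have hne : ∀ t ∈ Set.Icc δ 1, t ≠ 0 := fun t ht => (hδ.trans_le ht.1).ne'
  have h : ContDiffOn ℝ 1 (fun t : ℝ => (1 + t ^ α) / t) (Set.Icc δ 1) :=
    (contDiffOn_const.add (contDiffOn_id.rpow_const_of_ne hne)).div contDiffOn_id hne
  exact h.exists_lipschitzOnWith one_ne_zero (convex_Icc δ 1) isCompact_Icc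

/-- A radial rescaling `x ↦ φ (max ‖x‖ δ) • x` is Lipschitz on the closed unit ball when
`φ` is Lipschitz on `[δ, 1]`. -/
theorem exists_norm_smul_sub_smul_le {E : Type*} [NormedAddCommGroup E] [NormedSpace ℝ E]
    {φ : ℝ → ℝ} {δ : ℝ} (hδ : δ ≤ 1) {K : NNReal}
    (hφ : ∀ s ∈ Set.Icc δ 1, ∀ t ∈ Set.Icc δ 1, |φ s - φ t| ≤ K * |s - t|) :
    ∃ L : ℝ, ∀ x ∈ Metric.closedBall (0 : E) 1, ∀ y ∈ Metric.closedBall (0 : E) 1,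
      ‖φ (max ‖x‖ δ) • x - φ (max ‖y‖ δ) • y‖ ≤ L * ‖x - y‖ := by
  refine ⟨|φ 1| + K * |1 - δ| + K, fun x hx y hy => ?_⟩
  rw [mem_closedBall_zero_iff] at hx hy
  have hxr : max ‖x‖ δ ∈ Set.Icc δ 1 := ⟨le_max_right _ _, max_le hx hδ⟩
  have hyr : max ‖y‖ δ ∈ Set.Icc δ 1 := ⟨le_max_right _ _, max_le hy hδ⟩
  have hbound : |φ (max ‖x‖ δ)| ≤ |φ 1| + K * |1 - δ| := by
    have h1 := hφ _ hxr 1 ⟨hδ, le_rfl⟩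
    have h2 : |max ‖x‖ δ - 1| ≤ |1 - δ| := by
      rw [abs_sub_comm, abs_of_nonneg (sub_nonneg.2 hxr.2), abs_of_nonneg (sub_nonneg.2 hδ)]
      linarith [hxr.1]
    have h3 := mul_le_mul_of_nonneg_left h2 K.coe_nonneg
    have h4 := abs_sub_abs_le_abs_sub (φ (max ‖x‖ δ)) (φ 1)
    linarith
  have hdiff : |φ (max ‖x‖ δ) - φ (max ‖y‖ δ)| ≤ K * ‖x - y‖ :=
    (hφ _ hxr _ hyr).trans <| mul_le_mul_of_nonneg_left
      ((abs_max_sub_max_le_abs _ _ _).trans (abs_norm_sub_norm_le x y)) K.coe_nonneg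
  calc ‖φ (max ‖x‖ δ) • x - φ (max ‖y‖ δ) • y‖
      = ‖φ (max ‖x‖ δ) • (x - y) + (φ (max ‖x‖ δ) - φ (max ‖y‖ δ)) • y‖ := by
        congr 1; module
    _ ≤ |φ (max ‖x‖ δ)| * ‖x - y‖ + |φ (max ‖x‖ δ) - φ (max ‖y‖ δ)| * ‖y‖ := by
        simpa only [norm_smul, Real.norm_eq_abs] using
          norm_add_le (φ (max ‖x‖ δ) • (x - y)) ((φ (max ‖x‖ δ) - φ (max ‖y‖ δ)) • y)
    _ ≤ (|φ 1| + K * |1 - δ|) * ‖x - y‖ + K * ‖x - y‖ * 1 := by gcongr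
    _ = (|φ 1| + K * |1 - δ| + K) * ‖x - y‖ := by ring

/-- For `n ≥ 2`, `0 < α < 1` and `m ≥ 1`, the piecewise map
`g_m(x) = ((1+‖x‖^α)/‖x‖)·x` for `1/m ≤ ‖x‖` and
`g_m(x) = m·(1+(1/m)^α)·x` for `‖x‖ < 1/m`
is Lipschitz on the closed unit ball of `ℝⁿ`. -/
theorem gm_lipschitz_on_closed_ball
    (n : ℕ) (hn : 2 ≤ n) (α : ℝ) (hα₀ : 0 < α) (hα₁ : α < 1)
    (m : ℕ) (hm : 1 ≤ m)
    (gm : EuclideanSpace ℝ (Fin n) → EuclideanSpace ℝ (Fin n))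
    (hgm : ∀ x : EuclideanSpace ℝ (Fin n),
      gm x = if (1 : ℝ) / m ≤ ‖x‖ then ((1 + ‖x‖ ^ α) / ‖x‖) • x
             else ((m : ℝ) * (1 + ((1 : ℝ) / m) ^ α)) • x) :
    ∃ L : ℝ, ∀ x ∈ Metric.closedBall (0 : EuclideanSpace ℝ (Fin n)) 1,
      ∀ y ∈ Metric.closedBall (0 : EuclideanSpace ℝ (Fin n)) 1,
        ‖gm x - gm y‖ ≤ L * ‖x - y‖ := by
  have hm' : (1 : ℝ) ≤ m := by exact_mod_cast hm
  have hδ : (0 : ℝ) < 1 / m := by positivity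
  obtain ⟨K, hK⟩ := exists_lipschitzOnWith_one_add_rpow_div α hδ
  obtain ⟨L, hL⟩ := exists_norm_smul_sub_smul_le (E := EuclideanSpace ℝ (Fin n))
    ((div_le_one (by positivity)).2 hm') fun s hs t ht => hK.dist_le_mul s hs t ht
  have hg : ∀ x, gm x =
      ((1 + (max ‖x‖ (1 / m : ℝ)) ^ α) / max ‖x‖ (1 / m : ℝ)) • x := by
    intro x
    rw [hgm]
    split_ifs with h
    · rw [max_eq_left h]
    · rw [max_eq_right (not_le.1 h).le]
      congr 1
      field_simp
  exact ⟨L, fun x hx y hy => by simpa only [hg] using hL x hx y hy⟩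
end

section
/- Let n ≥ 2, 0 < α < 1, and m ≥ 1 a natural number. The map g_m, defined on the open unit ball of ℝⁿ by g_m(x) = ((1+‖x‖^α)/‖x‖)·x for 1/m ≤ ‖x‖ < 1 and g_m(x) = m·(1+(1/m)^α)·x for ‖x‖ < 1/m, is a homeomorphism of the open unit ball B(0,1) onto the open ball B(0,2). -/
/-- The map that sends `x ≠ 0` to the point of norm `φ ‖x‖` in the direction of `x`. -/
noncomputable def radialMap {E : Type*} [NormedAddCommGroup E] [NormedSpace ℝ E]
    (φ : ℝ → ℝ) (x : E) : E :=
  (φ ‖x‖ / ‖x‖) • x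

section RadialMap

variable {E : Type*} [NormedAddCommGroup E] [NormedSpace ℝ E]

theorem norm_radialMap {φ : ℝ → ℝ} (h0 : φ 0 = 0) (hφ : ∀ r, 0 ≤ r → 0 ≤ φ r) (x : E) :
    ‖radialMap φ x‖ = φ ‖x‖ := by
  rcases eq_or_ne x 0 with rfl | hx
  · simp [radialMap, h0]
  · have hx' : ‖x‖ ≠ 0 := norm_ne_zero_iff.2 hx
    rw [radialMap, norm_smul, Real.norm_of_nonneg
      (div_nonneg (hφ _ (norm_nonneg x)) (norm_nonneg x)), div_mul_cancel₀ _ hx']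

theorem continuous_radialMap {φ : ℝ → ℝ} (h0 : φ 0 = 0) (hφ : ∀ r, 0 ≤ r → 0 ≤ φ r)
    (hc : Continuous φ) : Continuous (radialMap φ : E → E) := by
  rw [continuous_iff_continuousAt]
  intro x
  rcases eq_or_ne x 0 with rfl | hx
  · have hz : radialMap φ (0 : E) = 0 := by simp [radialMap]
    rw [ContinuousAt, hz, tendsto_zero_iff_norm_tendsto_zero]
    simp_rw [norm_radialMap h0 hφ]
    have h : Continuous fun y : E => φ ‖y‖ := hc.comp continuous_norm
    simpa [h0] using h.tendsto (0 : E)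
  · exact ((hc.comp continuous_norm).continuousAt.div continuous_norm.continuousAt
      (norm_ne_zero_iff.2 hx)).smul continuousAt_id

theorem radialMap_radialMap {φ ψ : ℝ → ℝ} (h0 : φ 0 = 0) (hφ : ∀ r, 0 ≤ r → 0 ≤ φ r)
    (hψ : Function.LeftInverse ψ φ) (x : E) : radialMap ψ (radialMap φ x) = x := by
  rcases eq_or_ne x 0 with rfl | hx
  · simp [radialMap]
  · have hx' : ‖x‖ ≠ 0 := norm_ne_zero_iff.2 hx
    have hφx : φ ‖x‖ ≠ 0 := fun h => hx' (hψ.injective (h.trans h0.symm))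
    rw [radialMap, norm_radialMap h0 hφ, hψ, radialMap, smul_smul,
      div_mul_div_cancel₀ hφx, div_self hx', one_smul]

/-- An order automorphism of `ℝ` fixing `0` induces a radial self-homeomorphism. -/
noncomputable def radialHomeomorph (φ : ℝ ≃o ℝ) (h0 : φ 0 = 0) : E ≃ₜ E where
  toFun := radialMap φ
  invFun := radialMap φ.symm
  left_inv := radialMap_radialMap h0 (fun _ hr => h0 ▸ φ.monotone hr) φ.symm_apply_apply
  right_inv := radialMap_radialMap (φ.symm_apply_eq.2 h0.symm)
    (fun _ hr => φ.symm_apply_eq.2 h0.symm ▸ φ.symm.monotone hr) φ.apply_symm_apply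
  continuous_toFun := continuous_radialMap h0 (fun _ hr => h0 ▸ φ.monotone hr) φ.continuous
  continuous_invFun := continuous_radialMap (φ.symm_apply_eq.2 h0.symm)
    (fun _ hr => φ.symm_apply_eq.2 h0.symm ▸ φ.symm.monotone hr) φ.symm.continuous

theorem radialHomeomorph_apply (φ : ℝ ≃o ℝ) (h0 : φ 0 = 0) (x : E) :
    radialHomeomorph φ h0 x = radialMap φ x :=
  rfl

theorem radialHomeomorph_mem_ball_iff (φ : ℝ ≃o ℝ) (h0 : φ 0 = 0) (r : ℝ) (x : E) :
    x ∈ Metric.ball (0 : E) r ↔ radialHomeomorph φ h0 x ∈ Metric.ball (0 : E) (φ r) := by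
  rw [mem_ball_zero_iff, mem_ball_zero_iff, radialHomeomorph_apply,
    norm_radialMap h0 fun _ hr => h0 ▸ φ.monotone hr, φ.lt_iff_lt]

end RadialMap

/-- The profile `r ↦ 1 + r ^ α` for `r ≥ s`, continued linearly below `s`. -/
noncomputable def linearPowerProfile (α s r : ℝ) : ℝ :=
  if s ≤ r then 1 + r ^ α else s⁻¹ * (1 + s ^ α) * r

section LinearPowerProfile

variable {α s : ℝ}

theorem linearPowerProfile_zero (hs : 0 < s) : linearPowerProfile α s 0 = 0 := by
  simp [linearPowerProfile, hs.not_ge]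

theorem linearPowerProfile_one (hs : s ≤ 1) : linearPowerProfile α s 1 = 2 := by
  rw [linearPowerProfile, if_pos hs, Real.one_rpow]
  norm_num

theorem continuous_linearPowerProfile (hα : 0 < α) (hs : 0 < s) :
    Continuous (linearPowerProfile α s) := by
  refine Continuous.if_le (continuous_const.add (Real.continuous_rpow_const hα.le))
    (continuous_const.mul continuous_id) continuous_const continuous_id ?_
  rintro x rfl
  field_simp

theorem strictMono_linearPowerProfile (hα : 0 < α) (hs : 0 < s) :
    StrictMono (linearPowerProfile α s) := by
  have hpow : 0 < s ^ α := Real.rpow_pos_of_pos hs α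
  have hk : 0 < s⁻¹ * (1 + s ^ α) := by positivity
  intro a b hab
  unfold linearPowerProfile
  split_ifs with ha hb hb
  · have := Real.rpow_lt_rpow (hs.le.trans ha) hab hα
    linarith
  · exact absurd (ha.trans hab.le) hb
  · calc s⁻¹ * (1 + s ^ α) * a < s⁻¹ * (1 + s ^ α) * s :=
          mul_lt_mul_of_pos_left (not_le.1 ha) hk
      _ = 1 + s ^ α := by field_simp
      _ ≤ 1 + b ^ α := by gcongr
  · exact mul_lt_mul_of_pos_left hab hk

theorem surjective_linearPowerProfile (hα : 0 < α) (hs : 0 < s) :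
    Function.Surjective (linearPowerProfile α s) := by
  have hpow : 0 < s ^ α := Real.rpow_pos_of_pos hs α
  have hk : 0 < s⁻¹ * (1 + s ^ α) := by positivity
  refine (continuous_linearPowerProfile hα hs).surjective ?_ ?_
  · refine (Filter.tendsto_atTop_add_const_left _ 1 (tendsto_rpow_atTop hα)).congr' ?_
    filter_upwards [Filter.eventually_ge_atTop s] with r hr
    rw [linearPowerProfile, if_pos hr]
  · refine (Filter.tendsto_id.const_mul_atBot hk).congr' ?_
    filter_upwards [Filter.eventually_lt_atBot s] with r hr
    rw [linearPowerProfile, if_neg hr.not_ge, id]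

end LinearPowerProfile


/-- For `n ≥ 2`, `0 < α < 1` and `m ≥ 1`, the piecewise map `g_m` is a
homeomorphism of the open unit ball `B(0,1)` of `ℝⁿ` onto the ball `B(0,2)`. -/
theorem gm_homeomorph_ball_onto_ball
    (n : ℕ) (hn : 2 ≤ n) (α : ℝ) (hα₀ : 0 < α) (hα₁ : α < 1)
    (m : ℕ) (hm : 1 ≤ m)
    (gm : EuclideanSpace ℝ (Fin n) → EuclideanSpace ℝ (Fin n))
    (hgm : ∀ x : EuclideanSpace ℝ (Fin n),
      gm x = if (1 : ℝ) / m ≤ ‖x‖ then ((1 + ‖x‖ ^ α) / ‖x‖) • x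
             else ((m : ℝ) * (1 + ((1 : ℝ) / m) ^ α)) • x) :
    ∃ e : Metric.ball (0 : EuclideanSpace ℝ (Fin n)) 1 ≃ₜ
          Metric.ball (0 : EuclideanSpace ℝ (Fin n)) 2,
      ∀ x : Metric.ball (0 : EuclideanSpace ℝ (Fin n)) 1,
        (e x : EuclideanSpace ℝ (Fin n)) = gm (x : EuclideanSpace ℝ (Fin n)) := by
  have hs : (0 : ℝ) < 1 / m := by positivity
  have hs₁ : (1 : ℝ) / m ≤ 1 := by
    rw [one_div]
    exact inv_le_one_of_one_le₀ (by exact_mod_cast hm)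
  let φ : ℝ ≃o ℝ := (strictMono_linearPowerProfile hα₀ hs).orderIsoOfSurjective _
    (surjective_linearPowerProfile hα₀ hs)
  have hφ₀ : φ 0 = 0 := linearPowerProfile_zero hs
  have hφ₁ : φ 1 = 2 := linearPowerProfile_one hs₁
  refine ⟨(radialHomeomorph φ hφ₀).subtype fun x =>
    hφ₁ ▸ radialHomeomorph_mem_ball_iff φ hφ₀ 1 x, fun x => ?_⟩
  change radialMap (linearPowerProfile α (1 / m)) (x : EuclideanSpace ℝ (Fin n)) = gm x
  rw [hgm, radialMap, linearPowerProfile]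
  split_ifs with h
  · rfl
  · rcases eq_or_ne (x : EuclideanSpace ℝ (Fin n)) 0 with hx | hx
    · simp [hx]
    · rw [mul_div_cancel_right₀ _ (norm_ne_zero_iff.2 hx), one_div, inv_inv]
end

section
/- Let n ≥ 2, 0 < α < 1, and let g(x) = ((1+‖x‖^α)/‖x‖)·x on ℝⁿ ∖ {0}. Then for every x with 0 < ‖x‖ < 1, g is differentiable at x and the determinant of its derivative (as a linear map ℝⁿ → ℝⁿ) equals α·‖x‖^{α−1}·((1+‖x‖^α)/‖x‖)^{n−1}. -/
open Module in
/-- The determinant of a rank-one perturbation of a nonzero multiple of the identity. -/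
theorem LinearMap.det_smul_id_add_smulRight {K V : Type*} [Field K] [AddCommGroup V] [Module K V]
    [FiniteDimensional K V] {c : K} (hc : c ≠ 0) (f : Dual K V) (v : V) :
    LinearMap.det (c • LinearMap.id + f.smulRight v) = c ^ finrank K V * (1 + c⁻¹ * f v) := by
  have h : c • LinearMap.id + f.smulRight v = c • LinearMap.transvection (c⁻¹ • f) v := by
    ext w
    simp [LinearMap.transvection.apply, smul_smul, hc]
  rw [h, LinearMap.det_smul, LinearMap.transvection.det]
  simp

section Radial

variable {E : Type*} [NormedAddCommGroup E] [InnerProductSpace ℝ E]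

theorem hasFDerivAt_norm_of_ne_zero {x : E} (hx : x ≠ 0) :
    HasFDerivAt (fun y : E => ‖y‖) (‖x‖⁻¹ • innerSL ℝ x) x := by
  have h := (hasStrictFDerivAt_norm_sq x).hasFDerivAt.sqrt (by simpa using hx)
  simp only [Real.sqrt_sq (norm_nonneg _)] at h
  convert h using 1
  ext y
  simp
  ring

theorem HasDerivAt.hasFDerivAt_radial {φ : ℝ → ℝ} {φ' : ℝ} {x : E} (hx : x ≠ 0)
    (hφ : HasDerivAt φ φ' ‖x‖) :
    HasFDerivAt (fun y : E => φ ‖y‖ • y)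
      (φ ‖x‖ • ContinuousLinearMap.id ℝ E + ((φ' * ‖x‖⁻¹) • innerSL ℝ x).smulRight x) x := by
  have h := (hφ.comp_hasFDerivAt x (hasFDerivAt_norm_of_ne_zero hx)).smul (hasFDerivAt_id x)
  rwa [smul_smul] at h

theorem det_radial_derivative [FiniteDimensional ℝ E] {c d : ℝ} (hc : c ≠ 0) {x : E}
    (hx : x ≠ 0) :
    LinearMap.det ((c • ContinuousLinearMap.id ℝ E +
      ((d * ‖x‖⁻¹) • innerSL ℝ x).smulRight x : E →L[ℝ] E) : E →ₗ[ℝ] E) =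
      c ^ Module.finrank ℝ E * (1 + c⁻¹ * (d * ‖x‖)) := by
  have hr : ‖x‖ ≠ 0 := norm_ne_zero_iff.mpr hx
  refine (LinearMap.det_smul_id_add_smulRight hc
    (((d * ‖x‖⁻¹) • innerSL ℝ x : E →L[ℝ] ℝ) : E →ₗ[ℝ] ℝ) x).trans ?_
  simp only [ContinuousLinearMap.coe_coe, smul_apply, innerSL_apply_apply,
    real_inner_self_eq_norm_sq, smul_eq_mul]
  field_simp

end Radial


/-- For `n ≥ 2`, `0 < α < 1` and `g(x) = ((1+‖x‖^α)/‖x‖)·x`, the map `g` is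
differentiable at every `x` with `0 < ‖x‖ < 1` and the determinant of its
Fréchet derivative equals `α·‖x‖^(α−1)·((1+‖x‖^α)/‖x‖)^(n−1)`. -/
theorem g_differentiable_and_jacobian_det
    (n : ℕ) (hn : 2 ≤ n) (α : ℝ) (hα₀ : 0 < α) (hα₁ : α < 1)
    (g : EuclideanSpace ℝ (Fin n) → EuclideanSpace ℝ (Fin n))
    (hg : ∀ x : EuclideanSpace ℝ (Fin n), x ≠ 0 →
      g x = ((1 + ‖x‖ ^ α) / ‖x‖) • x)
    (x : EuclideanSpace ℝ (Fin n)) (hx₀ : 0 < ‖x‖) (hx₁ : ‖x‖ < 1) :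
    DifferentiableAt ℝ g x ∧
    LinearMap.det (fderiv ℝ g x : EuclideanSpace ℝ (Fin n) →ₗ[ℝ] EuclideanSpace ℝ (Fin n)) =
      α * ‖x‖ ^ (α - 1) * ((1 + ‖x‖ ^ α) / ‖x‖) ^ (n - 1) := by
  have hx : x ≠ 0 := norm_pos_iff.mp hx₀
  have hr : ‖x‖ ≠ 0 := hx₀.ne'
  have hc : (1 + ‖x‖ ^ α) / ‖x‖ ≠ 0 := by positivity
  have hφ : HasDerivAt (fun t : ℝ => (1 + t ^ α) / t)
      ((α * ‖x‖ ^ (α - 1) * ‖x‖ - (1 + ‖x‖ ^ α) * 1) / ‖x‖ ^ 2) ‖x‖ :=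
    ((Real.hasDerivAt_rpow_const (Or.inl hr)).const_add 1).div (hasDerivAt_id _) hr
  have hD := (hφ.hasFDerivAt_radial hx).congr_of_eventuallyEq
    ((eventually_ne_nhds hx).mono hg)
  refine ⟨hD.differentiableAt, ?_⟩
  obtain ⟨m, rfl⟩ : ∃ m, n = m + 1 := ⟨n - 1, by omega⟩
  rw [hD.fderiv, det_radial_derivative hc hx, finrank_euclideanSpace_fin, Nat.add_sub_cancel,
    pow_succ]
  have h1 : 1 + ‖x‖ ^ α ≠ 0 := by positivity
  field_simp
  ring
end
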